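/- arXiv:2309.05522 — 2 statements merged into one kernel-verified Lean document; each statement's English description precedes it below -/
import Mathlib

section
/- Let p>1, ν ∈ S^{N−1}, and let F(x) = x − 2⟨x,ν⟩ν be the reflection across the hyperplane {x : ⟨x,ν⟩ = 0}. Let ρ ∈ A satisfy F_#(ρℒ^N) = ρℒ^N, and let π_ρ be the unique optimal transport plan between ρℒ^N and η_ρℒ^N, where η_ρ is the unique density realizing 𝒲_p(ρ). Then π_ρ({(x,y) ∈ ℝ^N×ℝ^N : ⟨x,ν⟩·⟨y,ν⟩ < 0}) = 0; that is, π_ρ transports no mass across the reflection hyperplane. -/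
open MeasureTheory ENNReal Set Metric Filter

noncomputable section

/-- Euclidean space `ℝ^N`. -/
abbrev Euc (N : ℕ) := EuclideanSpace ℝ (Fin N)

/-- The measure `ρ·γ` with density `ρ` with respect to `γ`. -/
def densM {α : Type*} [MeasurableSpace α] (γ : Measure α) (ρ : α → ℝ) : Measure α :=
  γ.withDensity fun x => ENNReal.ofReal (ρ x)

/-- `π` is a transport plan (coupling) with marginals `μ` and `ν`. -/
def IsCoupling {α : Type*} [MeasurableSpace α] (π : Measure (α × α)) (μ ν : Measure α) : Prop :=
  π.map Prod.fst = μ ∧ π.map Prod.snd = ν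

/-- Transport cost `∬ d(x,y)^p dπ(x,y)`. -/
def tCost {α : Type*} [MeasurableSpace α] [Dist α] (p : ℝ) (π : Measure (α × α)) : ℝ≥0∞ :=
  ∫⁻ z, ENNReal.ofReal (dist z.1 z.2 ^ p) ∂π

/-- The `p`-th power `W_p(μ,ν)^p` of the `p`-Wasserstein distance. -/
def WpPow {α : Type*} [MeasurableSpace α] [Dist α] (p : ℝ) (μ ν : Measure α) : ℝ≥0∞ :=
  ⨅ (π : Measure (α × α)) (_ : IsCoupling π μ ν), tCost p π

/-- The `p`-Wasserstein distance `W_p(μ,ν)`. -/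
def Wp {α : Type*} [MeasurableSpace α] [Dist α] (p : ℝ) (μ ν : Measure α) : ℝ≥0∞ :=
  WpPow p μ ν ^ (1 / p)

/-- `ρ'` is an admissible competitor for the energy `𝒲_p(ρ)`:
measurable, nonnegative, `ρ + ρ' ≤ 1` a.e., same total mass as `ρ`. -/
def Adm {α : Type*} [MeasurableSpace α] (γ : Measure α) (ρ ρ' : α → ℝ) : Prop :=
  Measurable ρ' ∧ (∀ x, 0 ≤ ρ' x) ∧ (∀ᵐ x ∂γ, ρ x + ρ' x ≤ 1) ∧
    ∫⁻ x, ENNReal.ofReal (ρ' x) ∂γ = ∫⁻ x, ENNReal.ofReal (ρ x) ∂γ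

/-- The `p`-th power `𝒲_p(ρ)^p` of the Wasserstein energy of a density `ρ`. -/
def WEnergyPow {α : Type*} [MeasurableSpace α] [Dist α] (p : ℝ) (γ : Measure α) (ρ : α → ℝ) :
    ℝ≥0∞ :=
  ⨅ (ρ' : α → ℝ) (_ : Adm γ ρ ρ'), WpPow p (densM γ ρ) (densM γ ρ')

/-- The Wasserstein energy `𝒲_p(ρ) = inf { W_p(ργ, ρ'γ) : ρ' admissible }`. -/
def WEnergy {α : Type*} [MeasurableSpace α] [Dist α] (p : ℝ) (γ : Measure α) (ρ : α → ℝ) :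
    ℝ≥0∞ :=
  WEnergyPow p γ ρ ^ (1 / p)

/-- The class `A_m` of densities with values in `[0,1]` and total mass `m`. -/
def memA {α : Type*} [MeasurableSpace α] (γ : Measure α) (m : ℝ) (ρ : α → ℝ) : Prop :=
  Measurable ρ ∧ (∀ᵐ x ∂γ, 0 ≤ ρ x ∧ ρ x ≤ 1) ∧ ∫ x, ρ x ∂γ = m

/-- The class `AP_ρ` of admissible plans: first marginal `ργ`, second marginal `≤ (1-ρ)γ`. -/
def AP {α : Type*} [MeasurableSpace α] (γ : Measure α) (ρ : α → ℝ) (π : Measure (α × α)) : Prop :=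
  π.map Prod.fst = densM γ ρ ∧ π.map Prod.snd ≤ densM γ fun x => 1 - ρ x

/-- `z` belongs to the support of the measure `μ`. -/
def inSupport {α : Type*} [TopologicalSpace α] [MeasurableSpace α] (μ : Measure α) (z : α) :
    Prop :=
  ∀ U : Set α, IsOpen U → z ∈ U → 0 < μ U

section Densities

variable {α : Type*} [MeasurableSpace α] {γ : Measure α} {ρ : α → ℝ}

theorem memA.lintegral_eq {m : ℝ} (hρ : memA γ m ρ) (hm : m ≠ 0) :
    ∫⁻ x, ENNReal.ofReal (ρ x) ∂γ = ENNReal.ofReal m := by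
  obtain ⟨-, h01, hint⟩ := hρ
  have hi : Integrable ρ γ := by
    by_contra h
    exact hm (by rw [← hint, integral_undef h])
  rw [← hint, ofReal_integral_eq_lintegral_ofReal hi (h01.mono fun x hx => hx.1)]

theorem densM_univ : densM γ ρ univ = ∫⁻ x, ENNReal.ofReal (ρ x) ∂γ := by
  rw [densM, withDensity_apply _ MeasurableSet.univ, Measure.restrict_univ]

theorem densM_add_densM_one_sub (hρ : Measurable ρ) (h01 : ∀ᵐ x ∂γ, 0 ≤ ρ x ∧ ρ x ≤ 1) :
    densM γ ρ + densM γ (fun x => 1 - ρ x) = γ := by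
  rw [densM, densM, ← withDensity_add_left (by fun_prop)]
  conv_rhs => rw [← withDensity_one (μ := γ)]
  refine withDensity_congr_ae (h01.mono fun x hx => ?_)
  simp only [Pi.add_apply, Pi.one_apply]
  rw [← ENNReal.ofReal_add hx.1 (by linarith [hx.2])]
  simp

/-- A finite measure dominated by `(1 - ρ)γ` with the mass of `ργ` is `ηγ` for an admissible
density `η`. -/
theorem exists_adm_of_le_densM_one_sub [SigmaFinite γ]
    (h01 : ∀ᵐ x ∂γ, 0 ≤ ρ x ∧ ρ x ≤ 1) (τ : Measure α) [IsFiniteMeasure τ]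
    (hτ : τ ≤ densM γ fun x => 1 - ρ x) (hmass : τ univ = densM γ ρ univ) :
    ∃ η, Adm γ ρ η ∧ densM γ η = τ := by
  have hac : τ ≪ γ := (Measure.absolutelyContinuous_of_le hτ).trans
    (withDensity_absolutelyContinuous _ _)
  have hdens : densM γ (fun x => (τ.rnDeriv γ x).toReal) = τ := by
    conv_rhs => rw [← Measure.withDensity_rnDeriv_eq τ γ hac]
    refine withDensity_congr_ae ((Measure.rnDeriv_lt_top τ γ).mono fun x hx => ?_)
    exact ENNReal.ofReal_toReal hx.ne
  refine ⟨fun x => (τ.rnDeriv γ x).toReal, ⟨(Measure.measurable_rnDeriv τ γ).ennreal_toReal,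
    fun x => ENNReal.toReal_nonneg, ?_, ?_⟩, hdens⟩
  · have hle : τ.rnDeriv γ ≤ᵐ[γ] fun x => ENNReal.ofReal (1 - ρ x) := by
      refine ae_le_of_forall_setLIntegral_le_of_sigmaFinite (Measure.measurable_rnDeriv τ γ)
        fun s hs _ => ?_
      rw [← withDensity_apply _ hs, ← withDensity_apply _ hs,
        Measure.withDensity_rnDeriv_eq τ γ hac]
      exact hτ s
    filter_upwards [hle, h01] with x hx h1
    have := ENNReal.toReal_le_of_le_ofReal (by linarith [h1.2]) hx
    linarith
  · rw [← densM_univ, ← densM_univ, hdens, hmass]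

/-- The energy of `ρ` is at most the cost of any admissible plan. -/
theorem WEnergyPow_le_tCost [Dist α] [SigmaFinite γ] (p : ℝ)
    (h01 : ∀ᵐ x ∂γ, 0 ≤ ρ x ∧ ρ x ≤ 1) (hfin : densM γ ρ univ ≠ ⊤)
    {κ : Measure (α × α)} (hκ : AP γ ρ κ) : WEnergyPow p γ ρ ≤ tCost p κ := by
  have hmass : κ.map Prod.snd univ = densM γ ρ univ := by
    rw [← hκ.1, Measure.map_apply measurable_snd .univ, Measure.map_apply measurable_fst .univ,
      preimage_univ, preimage_univ]
  have : IsFiniteMeasure (κ.map Prod.snd) := ⟨by rw [hmass]; exact hfin.lt_top⟩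
  obtain ⟨η, hη, hdens⟩ := exists_adm_of_le_densM_one_sub h01 _ hκ.2 hmass
  exact (iInf₂_le η hη).trans (iInf₂_le κ ⟨hκ.1, hdens.symm⟩)

theorem Adm.densM_le {η : α → ℝ} (hη : Adm γ ρ η) :
    densM γ η ≤ densM γ fun x => 1 - ρ x :=
  withDensity_mono (hη.2.2.1.mono fun x hx => ENNReal.ofReal_le_ofReal (by linarith))

/-- If an involution preserves `γ` and `ργ`, it preserves `(1 - ρ)γ`. -/
theorem map_densM_one_sub [SigmaFinite γ] (hρ : Measurable ρ) {F : α → α}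
    (hF : MeasurePreserving F γ γ) (hinv : Function.Involutive F)
    (hFρ : (densM γ ρ).map F = densM γ ρ) (h01 : ∀ᵐ x ∂γ, 0 ≤ ρ x ∧ ρ x ≤ 1) :
    (densM γ fun x => 1 - ρ x).map F = densM γ fun x => 1 - ρ x := by
  have key : ∀ f : α → ℝ, Measurable f → (densM γ f).map F = densM γ (f ∘ F) := by
    intro f hf
    ext s hs
    rw [Measure.map_apply hF.measurable hs, densM, densM,
      withDensity_apply _ (hF.measurable hs), withDensity_apply _ hs,
      ← hF.setLIntegral_comp_preimage hs
        (f := fun x => ENNReal.ofReal ((f ∘ F) x)) (by have := hF.measurable; fun_prop)]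
    simp [hinv _]
  rw [key ρ hρ] at hFρ
  rw [key _ (by fun_prop)]
  have h := (withDensity_eq_iff_of_sigmaFinite (by have := hF.measurable; fun_prop)
    (by fun_prop)).1 hFρ
  have h01' := hF.quasiMeasurePreserving.ae h01
  refine withDensity_congr_ae ?_
  filter_upwards [h, h01, h01'] with x hx h1 h2
  have : ρ (F x) = ρ x := by
    simpa [ENNReal.ofReal_eq_ofReal_iff h2.1 h1.1] using hx
  simp [this]

/-- Glueing the normalized products of `ργ` and `(1 - ρ)γ` on the cells of a partition of
uniformly bounded diameter gives an admissible plan of finite cost. -/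
theorem exists_AP_tCost_lt_top {ι : Type*} [Countable ι] [Dist α] [SFinite γ] {p : ℝ} (hp : 0 ≤ p)
    (hd : ∀ x y : α, 0 ≤ dist x y)
    (hρ : Measurable ρ) (h01 : ∀ᵐ x ∂γ, 0 ≤ ρ x ∧ ρ x ≤ 1)
    (hmass : densM γ ρ univ ≤ 1) {Q : ι → Set α} (hQm : ∀ k, MeasurableSet (Q k))
    (hQd : Pairwise (Function.onFun Disjoint Q)) (hQu : ⋃ k, Q k = univ)
    (hQ2 : ∀ k, 2 ≤ γ (Q k)) (hQt : ∀ k, γ (Q k) ≠ ⊤) {D : ℝ}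
    (hD : ∀ k, ∀ x ∈ Q k, ∀ y ∈ Q k, dist x y ≤ D) :
    ∃ κ : Measure (α × α), AP γ ρ κ ∧ tCost p κ < ⊤ := by
  set μ := densM γ ρ with hμ
  set ν := densM γ fun x => 1 - ρ x with hν
  have hadd : μ + ν = γ := densM_add_densM_one_sub hρ h01
  have : SFinite μ := by rw [hμ, densM]; infer_instance
  have : SFinite ν := by rw [hν, densM]; infer_instance
  have ha : ∀ k, μ (Q k) ≤ 1 := fun k => (measure_mono (subset_univ _)).trans hmass
  have hsum : ∀ k, μ (Q k) + ν (Q k) = γ (Q k) := fun k => by rw [← Measure.add_apply, hadd]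
  have hb : ∀ k, 1 ≤ ν (Q k) := fun k => by
    have h : (1 : ℝ≥0∞) + 1 ≤ 1 + ν (Q k) := by
      rw [one_add_one_eq_two]
      exact ((hQ2 k).trans (hsum k).ge).trans (by gcongr; exact ha k)
    exact (ENNReal.add_le_add_iff_left ENNReal.one_ne_top).1 h
  have hbt : ∀ k, ν (Q k) ≠ ⊤ := fun k =>
    ((le_add_self.trans (hsum k).le).trans_lt (hQt k).lt_top).ne
  have hb0 : ∀ k, ν (Q k) ≠ 0 := fun k => (zero_lt_one.trans_le (hb k)).ne'
  have hres : ∀ θ : Measure α, Measure.sum (fun k => θ.restrict (Q k)) = θ := fun θ => by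
    rw [← Measure.restrict_iUnion hQd hQm, hQu, Measure.restrict_univ]
  set κ : Measure (α × α) := Measure.sum fun k =>
    (ν (Q k))⁻¹ • ((μ.restrict (Q k)).prod (ν.restrict (Q k))) with hκ
  have hfst : κ.map Prod.fst = μ := by
    rw [hκ, Measure.map_sum measurable_fst.aemeasurable]
    conv_rhs => rw [← hres μ]
    congr 1
    ext1 k
    rw [Measure.map_smul, Measure.map_fst_prod, Measure.restrict_apply_univ, smul_smul,
      ENNReal.inv_mul_cancel (hb0 k) (hbt k), one_smul]
  refine ⟨κ, ⟨hfst, ?_⟩, ?_⟩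
  · rw [hκ, Measure.map_sum measurable_snd.aemeasurable]
    conv_rhs => rw [← hν, ← hres ν]
    refine Measure.le_iff.2 fun s hs => ?_
    rw [Measure.sum_apply _ hs, Measure.sum_apply _ hs]
    refine ENNReal.tsum_le_tsum fun k => ?_
    rw [Measure.map_smul, Measure.map_snd_prod, Measure.restrict_apply_univ, smul_smul,
      Measure.smul_apply, smul_eq_mul]
    refine mul_le_of_le_one_left' ?_
    rw [mul_comm]
    exact ENNReal.div_le_of_le_mul (by rw [one_mul]; exact (ha k).trans (hb k))
  · have hae : ∀ᵐ z ∂κ, ENNReal.ofReal (dist z.1 z.2 ^ p) ≤ ENNReal.ofReal (D ^ p) := by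
      rw [hκ, Measure.ae_sum_iff]
      intro k
      refine Measure.ae_smul_measure ?_ _
      rw [Measure.prod_restrict]
      filter_upwards [ae_restrict_mem ((hQm k).prod (hQm k))] with z hz
      exact ENNReal.ofReal_le_ofReal
        (Real.rpow_le_rpow (hd _ _) (hD k _ hz.1 _ hz.2) hp)
    have hκ1 : κ univ ≤ 1 := by
      have h : κ.map Prod.fst univ ≤ 1 := by rw [hfst]; exact hmass
      rwa [Measure.map_apply measurable_fst .univ, preimage_univ] at h
    calc tCost p κ ≤ ∫⁻ _, ENNReal.ofReal (D ^ p) ∂κ := lintegral_mono_ae hae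
      _ = ENNReal.ofReal (D ^ p) * κ univ := lintegral_const _
      _ < ⊤ := ENNReal.mul_lt_top ENNReal.ofReal_lt_top (hκ1.trans_lt ENNReal.one_lt_top)

end Densities

section Cubes

/-- The cube `∏ᵢ [2kᵢ, 2kᵢ + 2)`. -/
def dyadicCube {N : ℕ} (k : Fin N → ℤ) : Set (Euc N) :=
  (MeasurableEquiv.toLp 2 (Fin N → ℝ)).symm ⁻¹'
    univ.pi fun i => Ico (2 * (k i : ℝ)) (2 * (k i : ℝ) + 2)

variable {N : ℕ}

theorem mem_dyadicCube {k : Fin N → ℤ} {x : Euc N} :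
    x ∈ dyadicCube k ↔ ∀ i, ⌊x i / 2⌋ = k i := by
  have h : x ∈ dyadicCube k ↔ ∀ i, 2 * (k i : ℝ) ≤ x i ∧ x i < 2 * (k i : ℝ) + 2 := by
    simp [dyadicCube, Set.mem_pi]
  rw [h]
  refine forall_congr' fun i => ?_
  rw [Int.floor_eq_iff]
  constructor <;> rintro ⟨h1, h2⟩ <;> constructor <;> linarith

theorem measurableSet_dyadicCube (k : Fin N → ℤ) : MeasurableSet (dyadicCube k) :=
  (MeasurableEquiv.measurable _) (MeasurableSet.univ_pi fun _ => measurableSet_Ico)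

theorem volume_dyadicCube (k : Fin N → ℤ) : volume (dyadicCube k) = 2 ^ N := by
  rw [dyadicCube, (EuclideanSpace.volume_preserving_symm_measurableEquiv_toLp
    (Fin N)).measure_preimage_equiv, Real.volume_pi_Ico]
  simp

theorem pairwise_disjoint_dyadicCube :
    Pairwise (Function.onFun Disjoint (dyadicCube (N := N))) := by
  intro k l hkl
  refine Set.disjoint_left.2 fun x hk hl => hkl ?_
  rw [mem_dyadicCube] at hk hl
  ext i
  rw [← hk i, ← hl i]

theorem iUnion_dyadicCube : ⋃ k, dyadicCube (N := N) k = univ :=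
  eq_univ_of_forall fun x => mem_iUnion.2 ⟨fun i => ⌊x i / 2⌋, mem_dyadicCube.2 fun _ => rfl⟩

theorem dist_le_of_mem_dyadicCube (k : Fin N → ℤ) (x : Euc N) (hx : x ∈ dyadicCube k)
    (y : Euc N) (hy : y ∈ dyadicCube k) : dist x y ≤ √(N * 4) := by
  rw [mem_dyadicCube] at hx hy
  rw [EuclideanSpace.dist_eq]
  refine Real.sqrt_le_sqrt ?_
  calc ∑ i, dist (x i) (y i) ^ 2 ≤ ∑ _i : Fin N, (4 : ℝ) := by
        refine Finset.sum_le_sum fun i _ => ?_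
        have h := Int.abs_sub_lt_one_of_floor_eq_floor ((hx i).trans (hy i).symm)
        rw [Real.dist_eq, sq_abs]
        rw [abs_lt] at h
        nlinarith [h.1, h.2]
    _ = N * 4 := by simp

/-- In positive dimension, the Wasserstein energy of a density of mass one is finite. -/
theorem WEnergyPow_lt_top (hN : N ≠ 0) {p : ℝ} (hp : 0 ≤ p) {ρ : Euc N → ℝ}
    (hρ : memA volume 1 ρ) : WEnergyPow p volume ρ < ⊤ := by
  have hmass : densM volume ρ univ = 1 := by
    rw [densM_univ, hρ.lintegral_eq one_ne_zero, ENNReal.ofReal_one]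
  obtain ⟨κ, hκ, hκt⟩ := exists_AP_tCost_lt_top hp (fun x y => dist_nonneg) hρ.1 hρ.2.1 hmass.le
    measurableSet_dyadicCube pairwise_disjoint_dyadicCube iUnion_dyadicCube
    (fun k => by
      rw [volume_dyadicCube]
      exact le_self_pow₀ (by norm_num) hN)
    (fun k => by rw [volume_dyadicCube]; finiteness)
    dist_le_of_mem_dyadicCube
  exact (WEnergyPow_le_tCost p hρ.2.1 (by simp [hmass]) hκ).trans_lt hκt

end Cubes

section Folding

variable {α : Type*} [MeasurableSpace α]

/-- Replace the target `y` by `F y` on the pairs of `C`. -/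
def foldTarget (F : α → α) (C : Set (α × α)) [DecidablePred (· ∈ C)] (z : α × α) : α × α :=
  (z.1, if z ∈ C then F z.2 else z.2)

/-- The symmetrization under `F` of the plan obtained from `π` by reflecting targets on `C`. -/
def foldPlan (F : α → α) (C : Set (α × α)) [DecidablePred (· ∈ C)] (π : Measure (α × α)) :
    Measure (α × α) :=
  (2⁻¹ : ℝ≥0∞) • (π.map (foldTarget F C) + (π.map (foldTarget F C)).map (Prod.map F F))

variable {F : α → α} {C : Set (α × α)} [DecidablePred (· ∈ C)]

theorem measurable_foldTarget (hF : Measurable F) (hC : MeasurableSet C) :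
    Measurable (foldTarget F C) :=
  measurable_fst.prodMk (Measurable.ite hC (hF.comp measurable_snd) measurable_snd)

theorem half_smul_add_self (μ : Measure α) : (2⁻¹ : ℝ≥0∞) • (μ + μ) = μ := by
  rw [← two_smul ℝ≥0∞ μ, smul_smul, ENNReal.inv_mul_cancel two_ne_zero ENNReal.ofNat_ne_top,
    one_smul]

theorem map_fst_foldPlan (hF : Measurable F) (hC : MeasurableSet C) (π : Measure (α × α))
    (hπ : (π.map Prod.fst).map F = π.map Prod.fst) :
    (foldPlan F C π).map Prod.fst = π.map Prod.fst := by
  have hG := measurable_foldTarget hF hC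
  have h : (π.map (foldTarget F C)).map Prod.fst = π.map Prod.fst := by
    rw [Measure.map_map measurable_fst hG]
    rfl
  have h' : ((π.map (foldTarget F C)).map (Prod.map F F)).map Prod.fst = π.map Prod.fst := by
    rw [Measure.map_map measurable_fst (hF.prodMap hF), Prod.map_fst',
      ← Measure.map_map hF measurable_fst, h, hπ]
  rw [foldPlan, Measure.map_smul, Measure.map_add _ _ measurable_fst, h, h', half_smul_add_self]

theorem map_snd_foldPlan (hF : Measurable F) (hinv : Function.Involutive F)
    (hC : MeasurableSet C) (π : Measure (α × α)) :
    (foldPlan F C π).map Prod.snd =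
      (2⁻¹ : ℝ≥0∞) • (π.map Prod.snd + (π.map Prod.snd).map F) := by
  have hG := measurable_foldTarget hF hC
  rw [foldPlan, Measure.map_smul, Measure.map_add _ _ measurable_snd]
  congr 1
  ext s hs
  have hind : Measurable (s.indicator (1 : α → ℝ≥0∞)) := measurable_one.indicator hs
  simp only [Measure.add_apply]
  simp only [← lintegral_indicator_one hs]
  have hFF := hF.prodMap hF
  rw [Measure.map_map hFF hG, Measure.map_map measurable_snd hG,
    Measure.map_map measurable_snd (hFF.comp hG), Measure.map_map hF measurable_snd,
    lintegral_map hind (measurable_snd.comp hG),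
    lintegral_map hind (measurable_snd.comp (hFF.comp hG)), lintegral_map hind measurable_snd,
    lintegral_map hind (hF.comp measurable_snd),
    ← lintegral_add_left (by exact hind.comp (measurable_snd.comp hG)),
    ← lintegral_add_left (by fun_prop)]
  refine lintegral_congr fun z => ?_
  by_cases hz : z ∈ C
  · simp [foldTarget, hz, hinv _, add_comm]
  · simp [foldTarget, hz]

theorem lintegral_foldPlan (hF : Measurable F) (hC : MeasurableSet C) (π : Measure (α × α))
    {c : α × α → ℝ≥0∞} (hc : Measurable c) (hcF : ∀ z, c (Prod.map F F z) = c z) :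
    ∫⁻ z, c z ∂(foldPlan F C π) = ∫⁻ z, c (foldTarget F C z) ∂π := by
  have hG := measurable_foldTarget hF hC
  rw [foldPlan, lintegral_smul_measure, lintegral_add_measure, lintegral_map hc (hF.prodMap hF)]
  simp only [hcF]
  rw [lintegral_map hc hG, ← two_mul, smul_eq_mul, ← mul_assoc,
    ENNReal.inv_mul_cancel two_ne_zero ENNReal.ofNat_ne_top, one_mul]

/-- Folding an admissible plan along a symmetry of `ρ` gives an admissible plan. -/
theorem AP.foldPlan {γ : Measure α} {ρ : α → ℝ} {π : Measure (α × α)} (hπ : AP γ ρ π)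
    (hF : Measurable F) (hinv : Function.Involutive F) (hC : MeasurableSet C)
    (hFρ : (densM γ ρ).map F = densM γ ρ)
    (hFρ' : (densM γ fun x => 1 - ρ x).map F = densM γ fun x => 1 - ρ x) :
    AP γ ρ (foldPlan F C π) := by
  refine ⟨by rw [map_fst_foldPlan hF hC π (by rw [hπ.1, hFρ]), hπ.1], ?_⟩
  rw [map_snd_foldPlan hF hinv hC, ← half_smul_add_self (densM γ fun x => 1 - ρ x)]
  have h := Measure.map_mono hπ.2 hF
  rw [hFρ'] at h
  refine Measure.le_iff'.2 fun s => ?_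
  simp only [Measure.smul_apply, Measure.add_apply, smul_eq_mul]
  gcongr
  exact hπ.2

end Folding

section Reflection

variable {E : Type*} [NormedAddCommGroup E] [InnerProductSpace ℝ E]

theorem reflection_orthogonal_singleton_apply_of_norm_eq_one {v : E} (hv : ‖v‖ = 1) (x : E) :
    (ℝ ∙ v)ᗮ.reflection x = x - (2 * inner ℝ x v) • v := by
  rw [Submodule.reflection_orthogonal_apply, Submodule.reflection_singleton_apply, hv,
    real_inner_comm]
  simp [mul_smul, two_smul]

/-- Reflecting one of two points on opposite sides of a hyperplane brings them closer. -/
theorem dist_reflection_lt {v : E} (hv : ‖v‖ = 1) {x y : E}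
    (h : inner ℝ x v * inner ℝ y v < 0) :
    dist x (y - (2 * inner ℝ y v) • v) < dist x y := by
  have hsq : ‖x - (y - (2 * inner ℝ y v) • v)‖ ^ 2 =
      ‖x - y‖ ^ 2 + 4 * (inner ℝ x v * inner ℝ y v) := by
    rw [sub_sub_eq_add_sub, add_sub_right_comm, norm_add_sq_real, norm_smul, hv, inner_smul_right,
      inner_sub_left, mul_one, Real.norm_eq_abs, sq_abs]
    ring
  rw [dist_eq_norm, dist_eq_norm]
  exact lt_of_pow_lt_pow_left₀ 2 (norm_nonneg _) (by linarith)

end Reflection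

/-- If `ρ` is invariant under the reflection `F(x) = x - 2⟨x,ν⟩ν`, then the optimal
plan `π_ρ` transports no mass across the reflection hyperplane `{⟨x,ν⟩ = 0}`. -/
theorem reflection_no_crossing {N : ℕ} (p : ℝ) (hp : 1 < p)
    (ν : Euc N) (hν : ‖ν‖ = 1)
    (F : Euc N → Euc N) (hF : F = fun x => x - (2 * (inner ℝ x ν : ℝ)) • ν)
    (ρ : Euc N → ℝ) (hρ : memA volume 1 ρ)
    (hFρ : Measure.map F (densM volume ρ) = densM volume ρ)
    (η : Euc N → ℝ) (hη : Adm volume ρ η)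
    (hη_opt : WpPow p (densM volume ρ) (densM volume η) = WEnergyPow p volume ρ)
    (π : Measure (Euc N × Euc N)) (hπ : IsCoupling π (densM volume ρ) (densM volume η))
    (hπ_opt : tCost p π = WpPow p (densM volume ρ) (densM volume η)) :
    π {z : Euc N × Euc N | (inner ℝ z.1 ν : ℝ) * (inner ℝ z.2 ν : ℝ) < 0} = 0 := by
  classical
  set C := {z : Euc N × Euc N | (inner ℝ z.1 ν : ℝ) * (inner ℝ z.2 ν : ℝ) < 0} with hC_def
  have hN : N ≠ 0 := by
    rintro rfl
    simp [Subsingleton.elim ν 0] at hν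
  have hF' : F = (ℝ ∙ ν)ᗮ.reflection := by
    ext1 x
    rw [hF, reflection_orthogonal_singleton_apply_of_norm_eq_one hν]
  have hFm : MeasurePreserving F volume volume := by
    rw [hF']
    exact LinearIsometryEquiv.measurePreserving _
  have hinv : Function.Involutive F := by
    rw [hF']
    exact Submodule.reflection_involutive _
  have hdist : ∀ x y, dist (F x) (F y) = dist x y := by
    rw [hF']
    exact LinearIsometryEquiv.dist_map _
  have hC : MeasurableSet C := by
    refine measurableSet_lt (Continuous.measurable ?_) measurable_const
    fun_prop
  have hc : Measurable fun z : Euc N × Euc N => ENNReal.ofReal (dist z.1 z.2 ^ p) := by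
    fun_prop
  have hmass : densM volume ρ univ = 1 := by
    rw [densM_univ, hρ.lintegral_eq one_ne_zero, ENNReal.ofReal_one]
  have hAP : AP volume ρ π := ⟨hπ.1, hπ.2.trans_le hη.densM_le⟩
  have hfold : tCost p π ≤ ∫⁻ z, ENNReal.ofReal
      (dist (foldTarget F C z).1 (foldTarget F C z).2 ^ p) ∂π := by
    rw [hπ_opt, hη_opt, ← lintegral_foldPlan hFm.measurable hC π hc
      (by intro z; simp only [Prod.map_fst, Prod.map_snd, hdist])]
    exact WEnergyPow_le_tCost p hρ.2.1 (by simp [hmass])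
      (hAP.foldPlan hFm.measurable hinv hC hFρ (map_densM_one_sub hρ.1 hFm hinv hFρ hρ.2.1))
  have hlt : ∀ z ∈ C, ENNReal.ofReal (dist (foldTarget F C z).1 (foldTarget F C z).2 ^ p) <
      ENNReal.ofReal (dist z.1 z.2 ^ p) := by
    intro z hz
    have h := dist_reflection_lt hν hz
    have hpos : 0 < dist z.1 z.2 := dist_nonneg.trans_lt h
    rw [ENNReal.ofReal_lt_ofReal_iff (Real.rpow_pos_of_pos hpos p)]
    simp only [foldTarget, hz, if_true, hF]
    exact Real.rpow_lt_rpow dist_nonneg h (by linarith)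
  have hle : ∀ z, ENNReal.ofReal (dist (foldTarget F C z).1 (foldTarget F C z).2 ^ p) ≤
      ENNReal.ofReal (dist z.1 z.2 ^ p) := by
    intro z
    by_cases hz : z ∈ C
    · exact (hlt z hz).le
    · simp [foldTarget, hz]
  have hfin : tCost p π ≠ ⊤ := by
    rw [hπ_opt, hη_opt]
    exact (WEnergyPow_lt_top hN (by linarith) hρ).ne
  by_contra hpos
  exact hfold.not_gt (lintegral_strict_mono_of_ae_le_of_ae_lt_on hc.aemeasurable
    (ne_top_of_le_ne_top hfin (lintegral_mono hle)) (.of_forall hle) hpos (.of_forall hlt))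
end
end

section
/- Let p>1 and let ρ ∈ A be a maximizer of 𝒲_p over A. Let ν ∈ S^{N−1} be such that ∫_{{x : ⟨x,ν⟩>0}} ρ dx = ∫_{{x : ⟨x,ν⟩<0}} ρ dx = 1/2. Then the unique optimal plan π_ρ (between ρℒ^N and the unique optimal density η_ρℒ^N) satisfies π_ρ({(x,y) : ⟨x,ν⟩·⟨y,ν⟩ < 0}) = 0. -/
open MeasureTheory ENNReal Set Metric Filter

noncomputable section

lemma measurable_dist_rpow {N : ℕ} (p : ℝ) :
    Measurable fun z : Euc N × Euc N => ENNReal.ofReal (dist z.1 z.2 ^ p) := by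
  fun_prop

lemma densM_univ_s11 {N : ℕ} {ρ : Euc N → ℝ} (hρ : memA volume 1 ρ) :
    densM volume ρ univ = 1 := by
  obtain ⟨-, h01, hint⟩ := hρ
  have hi : Integrable ρ volume := by
    by_contra h
    rw [integral_undef h] at hint
    exact zero_ne_one hint
  rw [densM, withDensity_apply _ MeasurableSet.univ, setLIntegral_univ,
    ← ofReal_integral_eq_lintegral_ofReal hi (h01.mono fun x hx => hx.1), hint, ENNReal.ofReal_one]

lemma measure_univ_of_map_fst {α : Type*} [MeasurableSpace α] {π : Measure (α × α)}
    {μ : Measure α} (h : π.map Prod.fst = μ) : π univ = μ univ := by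
  rw [← h, Measure.map_apply measurable_fst MeasurableSet.univ, preimage_univ]

lemma wEnergyPow_le_tCost {N : ℕ} {p : ℝ} {ρ : Euc N → ℝ} (hρ : memA volume 1 ρ)
    {π : Measure (Euc N × Euc N)} (hπ : AP volume ρ π) :
    WEnergyPow p volume ρ ≤ tCost p π := by
  obtain ⟨hfst, hsnd⟩ := hπ
  have hπ1 : π univ = 1 := (measure_univ_of_map_fst hfst).trans (densM_univ_s11 hρ)
  have : IsProbabilityMeasure π := ⟨hπ1⟩
  set τ := π.map Prod.snd with hτ
  have : IsProbabilityMeasure τ := Measure.isProbabilityMeasure_map measurable_snd.aemeasurable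
  have hac : τ ≪ volume :=
    (Measure.absolutelyContinuous_of_le hsnd).trans (withDensity_absolutelyContinuous _ _)
  have hrn := Measure.withDensity_rnDeriv_eq τ volume hac
  have hfin := Measure.rnDeriv_lt_top τ volume
  have hae : (fun x => ENNReal.ofReal (τ.rnDeriv volume x).toReal) =ᵐ[volume]
      τ.rnDeriv volume := by
    filter_upwards [hfin] with x hx using ENNReal.ofReal_toReal hx.ne
  have hle : τ.rnDeriv volume ≤ᵐ[volume] fun x => ENNReal.ofReal (1 - ρ x) := by
    refine ae_le_of_forall_setLIntegral_le_of_sigmaFinite (Measure.measurable_rnDeriv _ _) ?_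
    intro s hs _
    rw [← withDensity_apply _ hs, ← withDensity_apply _ hs, hrn]
    exact hsnd s
  have hdens : densM volume (fun x => (τ.rnDeriv volume x).toReal) = τ := by
    rw [densM, withDensity_congr_ae hae, hrn]
  have hadm : Adm volume ρ fun x => (τ.rnDeriv volume x).toReal := by
    refine ⟨(Measure.measurable_rnDeriv _ _).ennreal_toReal, fun x => ENNReal.toReal_nonneg, ?_, ?_⟩
    · filter_upwards [hle, hρ.2.1] with x hx h01
      have := ENNReal.toReal_mono ENNReal.ofReal_ne_top hx
      rw [ENNReal.toReal_ofReal (by linarith)] at this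
      linarith
    · rw [lintegral_congr_ae hae, ← setLIntegral_univ, ← withDensity_apply _ MeasurableSet.univ, hrn,
        measure_univ]
      have := densM_univ_s11 hρ
      rw [densM, withDensity_apply _ MeasurableSet.univ, setLIntegral_univ] at this
      exact this.symm
  exact (iInf₂_le _ hadm).trans (iInf₂_le π ⟨hfst, by rw [hdens]⟩)

lemma exists_two_le_volume_ball {N : ℕ} [Nontrivial (Euc N)] :
    ∃ R : ℝ, 0 < R ∧ ∀ x : Euc N, 2 ≤ volume (ball x R) := by
  have h1 : Tendsto (volume ∘ fun n : ℕ => ball (0 : Euc N) n) atTop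
      (nhds (volume (⋃ n : ℕ, ball (0 : Euc N) n))) :=
    tendsto_measure_iUnion_atTop fun m n h => ball_subset_ball (by exact_mod_cast h)
  rw [iUnion_ball_nat, measure_univ_of_isAddLeftInvariant] at h1
  obtain ⟨n, hn, hn1⟩ :=
    ((h1.eventually (lt_mem_nhds (ENNReal.ofNat_lt_top (n := 2)))).and (eventually_ge_atTop 1)).exists
  refine ⟨n, by exact_mod_cast hn1, fun x => ?_⟩
  rw [Measure.addHaar_ball_center]
  exact hn.le

lemma exists_AP_tCost_lt_top_s11 {N : ℕ} [Nontrivial (Euc N)] {p : ℝ} (hp : 0 ≤ p) {ρ : Euc N → ℝ}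
    (hρ : memA volume 1 ρ) :
    ∃ π : Measure (Euc N × Euc N), AP volume ρ π ∧ tCost p π < ∞ := by
  obtain ⟨R, hR, hball⟩ := exists_two_le_volume_ball (N := N)
  have hμ1 := densM_univ_s11 hρ
  obtain ⟨hm, h01, -⟩ := hρ
  set μ := densM volume ρ with hμ
  set κ := densM volume (fun x : Euc N => 1 - ρ x) with hκ
  have hμP : IsProbabilityMeasure μ := ⟨hμ1⟩
  have hκσ : SigmaFinite κ := by
    rw [hκ, densM]; exact SigmaFinite.withDensity_ofReal _
  have hκle : κ ≤ volume := by
    rw [hκ, densM]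
    conv_rhs => rw [← withDensity_one (μ := (volume : Measure (Euc N)))]
    refine withDensity_mono ?_
    filter_upwards [h01] with x hx
    simpa using hx.1
  have hvol : ∀ s, MeasurableSet s → volume s ≤ μ s + κ s := by
    intro s hs
    rw [hμ, hκ, densM, densM, withDensity_apply _ hs, withDensity_apply _ hs,
      ← lintegral_add_left (by fun_prop), ← setLIntegral_one]
    refine lintegral_mono_ae (ae_restrict_of_ae ?_)
    filter_upwards [h01] with x hx
    rw [← ENNReal.ofReal_add hx.1 (by linarith [hx.2])]
    simp
  set M : Euc N → ℝ≥0∞ := fun x => κ (ball x R) with hM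
  have hM1 : ∀ x, 1 ≤ M x := by
    intro x
    have h1 : (2 : ℝ≥0∞) ≤ 1 + M x := (hball x).trans ((hvol _ measurableSet_ball).trans
      (by gcongr; exact (measure_mono (subset_univ _)).trans hμ1.le))
    rw [← one_add_one_eq_two] at h1
    exact (ENNReal.add_le_add_iff_left ENNReal.one_ne_top).1 h1
  have hMtop : ∀ x, M x ≠ ∞ := fun x => ((hκle _).trans_lt measure_ball_lt_top).ne
  set D : Set (Euc N × Euc N) := {z | dist z.1 z.2 < R} with hD
  have hDm : MeasurableSet D := measurableSet_lt (by fun_prop) measurable_const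
  have hMm : Measurable M := by
    have hMD : M = fun x => κ (Prod.mk x ⁻¹' D) := by
      funext x
      refine congrArg κ (Set.ext fun y => ?_)
      rw [mem_ball, dist_comm]; rfl
    rw [hMD]
    exact measurable_measure_prodMk_left hDm
  set w : Euc N × Euc N → ℝ≥0∞ := D.indicator fun z => (M z.1)⁻¹ with hw
  have hwm : Measurable w := (hMm.comp measurable_fst).inv.indicator hDm
  have hx : ∀ x, ∫⁻ y, w (x, y) ∂κ = 1 := by
    intro x
    have : (fun y => w (x, y)) = (ball x R).indicator fun _ => (M x)⁻¹ := by
      ext y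
      simp [hw, hD, indicator, dist_comm]
    rw [this, lintegral_indicator measurableSet_ball, setLIntegral_const]
    exact ENNReal.inv_mul_cancel (zero_lt_one.trans_le (hM1 x)).ne' (hMtop x)
  have hy : ∀ y, ∫⁻ x, w (x, y) ∂μ ≤ 1 := by
    intro y
    calc ∫⁻ x, w (x, y) ∂μ ≤ ∫⁻ _, 1 ∂μ := by
          refine lintegral_mono fun x => ?_
          exact (indicator_le_self _ _ _).trans (ENNReal.inv_le_one.2 (hM1 x))
      _ = 1 := by simp
  have hfst : ((μ.prod κ).withDensity w).map Prod.fst = μ := by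
    ext s hs
    rw [Measure.map_apply measurable_fst hs, withDensity_apply _ (measurable_fst hs),
      ← prod_univ, ← Measure.prod_restrict, lintegral_prod _ hwm.aemeasurable]
    simp [hx]
  have hsnd : ((μ.prod κ).withDensity w).map Prod.snd ≤ κ := by
    refine Measure.le_iff.2 fun s hs => ?_
    rw [Measure.map_apply measurable_snd hs, withDensity_apply _ (measurable_snd hs),
      ← univ_prod, ← Measure.prod_restrict, lintegral_prod_symm _ hwm.aemeasurable,
      Measure.restrict_univ]
    calc ∫⁻ y in s, ∫⁻ x, w (x, y) ∂μ ∂κ ≤ ∫⁻ _ in s, 1 ∂κ := lintegral_mono fun y => hy y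
      _ = κ s := by simp
  refine ⟨(μ.prod κ).withDensity w, ⟨hfst, hsnd⟩, ?_⟩
  have htot : ∫⁻ z, w z ∂(μ.prod κ) = 1 := by
    rw [lintegral_prod _ hwm.aemeasurable]
    simp [hx]
  calc tCost p ((μ.prod κ).withDensity w)
      = ∫⁻ z, w z * ENNReal.ofReal (dist z.1 z.2 ^ p) ∂(μ.prod κ) :=
        lintegral_withDensity_eq_lintegral_mul _ hwm (measurable_dist_rpow p)
    _ ≤ ∫⁻ z, w z * ENNReal.ofReal (R ^ p) ∂(μ.prod κ) := by
        refine lintegral_mono fun z => ?_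
        by_cases hz : z ∈ D
        · gcongr
          exact le_of_lt hz
        · simp [hw, hz]
    _ = ENNReal.ofReal (R ^ p) := by
        rw [lintegral_mul_const _ hwm, htot, one_mul]
    _ < ∞ := ENNReal.ofReal_lt_top

/-- The decrease of cost obtained by exchanging the targets of two source points. -/
def swapGain {N : ℕ} (p : ℝ) (z z' : Euc N × Euc N) : ℝ :=
  dist z.1 z.2 ^ p + dist z'.1 z'.2 ^ p - (dist z.1 z'.2 ^ p + dist z'.1 z.2 ^ p)

lemma continuous_swapGain {N : ℕ} {p : ℝ} (hp : 0 ≤ p) :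
    Continuous fun q : (Euc N × Euc N) × (Euc N × Euc N) => swapGain p q.1 q.2 := by
  unfold swapGain
  have h : Continuous fun t : ℝ => t ^ p := Real.continuous_rpow_const hp
  fun_prop

lemma tCost_map {N : ℕ} {p : ℝ} {β : Type*} [MeasurableSpace β] (P : Measure β)
    {f : β → Euc N × Euc N} (hf : Measurable f) :
    tCost p (P.map f) = ∫⁻ z, ENNReal.ofReal (dist (f z).1 (f z).2 ^ p) ∂P :=
  lintegral_map (measurable_dist_rpow p) hf

lemma lintegral_swapGain_le {N : ℕ} {p : ℝ} (hp : 0 ≤ p) {ρ : Euc N → ℝ} (hρ : memA volume 1 ρ)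
    {π π' : Measure (Euc N × Euc N)} (hπ : AP volume ρ π) (hπ' : AP volume ρ π')
    (hopt : tCost p π = WEnergyPow p volume ρ) (hfin : tCost p π ≠ ∞) {ε : ℝ≥0∞} (hε : ε ≠ ∞)
    (hcost : tCost p π' ≤ tCost p π + ε) :
    ∫⁻ q, ENNReal.ofReal (swapGain p q.1 q.2) ∂(π.prod π') ≤ ε := by
  have hP1 : IsProbabilityMeasure π :=
    ⟨(measure_univ_of_map_fst hπ.1).trans (densM_univ_s11 hρ)⟩
  have hP2 : IsProbabilityMeasure π' :=
    ⟨(measure_univ_of_map_fst hπ'.1).trans (densM_univ_s11 hρ)⟩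
  set P := π.prod π' with hP
  set G : Set ((Euc N × Euc N) × (Euc N × Euc N)) := {q | 0 < swapGain p q.1 q.2} with hG
  have hGm : MeasurableSet G := (isOpen_lt continuous_const (continuous_swapGain hp)).measurableSet
  let c : Euc N → Euc N → ℝ≥0∞ := fun x y => ENNReal.ofReal (dist x y ^ p)
  have hnn : ∀ x y : Euc N, 0 ≤ dist x y ^ p := fun x y => Real.rpow_nonneg dist_nonneg _
  let s14 : (Euc N × Euc N) × (Euc N × Euc N) → Euc N × Euc N := fun q => (q.1.1, q.2.2)
  let s32 : (Euc N × Euc N) × (Euc N × Euc N) → Euc N × Euc N := fun q => (q.2.1, q.1.2)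
  have hs14 : Measurable s14 := by fun_prop
  have hs32 : Measurable s32 := by fun_prop
  let γ : Measure (Euc N × Euc N) := (P.restrict Gᶜ).map Prod.fst + (P.restrict Gᶜ).map Prod.snd +
    ((P.restrict G).map s14 + (P.restrict G).map s32)
  have hPfst : P.map Prod.fst = π := by simp [hP]
  have hPsnd : P.map Prod.snd = π' := by simp [hP]
  have hsplit : P.restrict Gᶜ + P.restrict G = P := by
    rw [add_comm]; exact Measure.restrict_add_restrict_compl hGm
  have hγfst : γ.map Prod.fst = π.map Prod.fst + π'.map Prod.fst := by
    simp only [γ]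
    conv_rhs => rw [← hPfst, ← hPsnd, ← hsplit]
    simp only [Measure.map_add, measurable_fst, measurable_snd,
      Measure.map_map, hs14, hs32]
    simp only [s14, s32, Function.comp_def]
    abel
  have hγsnd : γ.map Prod.snd = π.map Prod.snd + π'.map Prod.snd := by
    simp only [γ]
    conv_rhs => rw [← hPfst, ← hPsnd, ← hsplit]
    simp only [Measure.map_add, measurable_fst, measurable_snd,
      Measure.map_map, hs14, hs32]
    simp only [s14, s32, Function.comp_def]
    abel
  have hhalf : ∀ μ : Measure (Euc N), (2⁻¹ : ℝ≥0∞) • (μ + μ) = μ := by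
    intro μ
    rw [← two_smul ℝ≥0∞ μ, smul_smul, ENNReal.inv_mul_cancel (by simp) (by simp), one_smul]
  have hAP : AP volume ρ ((2⁻¹ : ℝ≥0∞) • γ) := by
    constructor
    · rw [Measure.map_smul, hγfst, hπ.1, hπ'.1, hhalf]
    · rw [Measure.map_smul, hγsnd, ← hhalf (densM volume fun x => 1 - ρ x)]
      have := add_le_add hπ.2 hπ'.2
      intro s
      simp only [Measure.smul_apply, smul_eq_mul]
      gcongr
  have h1 : 2 * tCost p π ≤ tCost p γ := by
    have h2 : tCost p π ≤ 2⁻¹ * tCost p γ := by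
      have := wEnergyPow_le_tCost (p := p) hρ hAP
      rw [← hopt] at this
      simpa [tCost, lintegral_smul_measure] using this
    calc 2 * tCost p π ≤ 2 * (2⁻¹ * tCost p γ) := by gcongr
      _ = tCost p γ := by rw [← mul_assoc, ENNReal.mul_inv_cancel (by simp) (by simp), one_mul]
  let A := ∫⁻ q in Gᶜ, (c q.1.1 q.1.2 + c q.2.1 q.2.2) ∂P
  let B := ∫⁻ q in G, (c q.1.1 q.2.2 + c q.2.1 q.1.2) ∂P
  let I := ∫⁻ q in G, ENNReal.ofReal (swapGain p q.1 q.2) ∂P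
  have hcm : Measurable fun z : Euc N × Euc N => c z.1 z.2 := measurable_dist_rpow p
  have hγcost : tCost p γ = A + B := by
    have e : tCost p γ = tCost p ((P.restrict Gᶜ).map Prod.fst)
        + tCost p ((P.restrict Gᶜ).map Prod.snd)
        + (tCost p ((P.restrict G).map s14) + tCost p ((P.restrict G).map s32)) := by
      simp [tCost, γ, lintegral_add_measure]
    rw [e, tCost_map _ measurable_fst, tCost_map _ measurable_snd, tCost_map _ hs14,
      tCost_map _ hs32]
    exact congrArg₂ (· + ·) (lintegral_add_left (hcm.comp measurable_fst) _).symm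
      (lintegral_add_left (hcm.comp hs14) _).symm
  have hcosts : tCost p π + tCost p π' = A + (B + I) := by
    have e1 : B + I = ∫⁻ q in G, (c q.1.1 q.1.2 + c q.2.1 q.2.2) ∂P := by
      refine (lintegral_add_left ((hcm.comp hs14).add (hcm.comp hs32)) _).symm.trans ?_
      refine setLIntegral_congr_fun hGm fun q hq => ?_
      simp only [c, Pi.add_apply, Function.comp_apply, s14, s32]
      have hq' : 0 < swapGain p q.1 q.2 := hq
      rw [← ENNReal.ofReal_add (hnn _ _) (hnn _ _), ← ENNReal.ofReal_add (hnn _ _) (hnn _ _),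
        ← ENNReal.ofReal_add (add_nonneg (hnn _ _) (hnn _ _)) hq'.le]
      congr 1
      simp only [swapGain]
      ring
    rw [e1, add_comm A, lintegral_add_compl _ hGm, ← hPfst, ← hPsnd, tCost_map _ measurable_fst,
      tCost_map _ measurable_snd]
    exact (lintegral_add_left (hcm.comp measurable_fst) _).symm
  have hI : ∫⁻ q, ENNReal.ofReal (swapGain p q.1 q.2) ∂P = I := by
    rw [← lintegral_add_compl _ hGm]
    have : ∫⁻ q in Gᶜ, ENNReal.ofReal (swapGain p q.1 q.2) ∂P = 0 := by
      rw [setLIntegral_congr_fun hGm.compl (g := fun _ => 0)]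
      · simp
      · intro q hq
        exact ENNReal.ofReal_of_nonpos (not_lt.1 hq)
    rw [this, add_zero]
  rw [hI]
  have hABfin : A + B ≠ ∞ := by
    refine ne_top_of_le_ne_top (b := tCost p π + tCost p π') ?_ ?_
    · exact ENNReal.add_ne_top.2 ⟨hfin, ne_top_of_le_ne_top (ENNReal.add_ne_top.2 ⟨hfin, hε⟩) hcost⟩
    · rw [hcosts, ← add_assoc]; exact le_self_add
  have : A + B + I ≤ A + B + ε := by
    calc A + B + I = tCost p π + tCost p π' := by rw [hcosts, add_assoc]
      _ ≤ tCost p π + (tCost p π + ε) := by gcongr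
      _ = 2 * tCost p π + ε := by ring
      _ ≤ A + B + ε := by rw [← hγcost]; gcongr
  exact (ENNReal.add_le_add_iff_left hABfin).1 this

/-- The open half space of the points with positive inner product with `ν`. -/
def halfSp {N : ℕ} (ν : Euc N) : Set (Euc N) := {x | 0 < (inner ℝ x ν : ℝ)}

/-- The folding of the space onto the closed half space in the direction `ν`. -/
def fold {N : ℕ} (ν x : Euc N) : Euc N := x + (|inner ℝ x ν| - inner ℝ x ν) • ν

lemma measurableSet_halfSp {N : ℕ} (ν : Euc N) : MeasurableSet (halfSp ν) :=
  measurableSet_lt measurable_const (by fun_prop)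

lemma mem_halfSp {N : ℕ} {ν x : Euc N} : x ∈ halfSp ν ↔ 0 < (inner ℝ x ν : ℝ) := Iff.rfl

lemma mem_halfSp_neg {N : ℕ} {ν x : Euc N} : x ∈ halfSp (-ν) ↔ (inner ℝ x ν : ℝ) < 0 := by
  simp [halfSp]

lemma continuous_fold {N : ℕ} (ν : Euc N) : Continuous (fold ν) := by
  unfold fold
  fun_prop

lemma inner_fold {N : ℕ} {ν : Euc N} (hν : ‖ν‖ = 1) (x : Euc N) :
    (inner ℝ (fold ν x) ν : ℝ) = |inner ℝ x ν| := by
  simp [fold, inner_add_left, real_inner_smul_left, hν]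

lemma fold_of_mem {N : ℕ} {ν x : Euc N} (hx : x ∈ halfSp ν) : fold ν x = x := by
  simp [fold, abs_of_pos (mem_halfSp.1 hx)]

lemma reflection_eq {N : ℕ} {ν : Euc N} (hν : ‖ν‖ = 1) (x : Euc N) :
    (Submodule.span ℝ {ν})ᗮ.reflection x = x - (2 * inner ℝ x ν) • ν := by
  rw [Submodule.reflection_orthogonal_apply, Submodule.reflection_singleton_apply, hν,
    real_inner_comm]
  simp [two_smul, add_smul, two_mul]

lemma fold_of_neg {N : ℕ} {ν x : Euc N} (hν : ‖ν‖ = 1) (hx : x ∈ halfSp (-ν)) :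
    fold ν x = (Submodule.span ℝ {ν})ᗮ.reflection x := by
  rw [reflection_eq hν, fold, abs_of_neg (mem_halfSp_neg.1 hx), sub_eq_add_neg x, ← neg_smul]
  congr 2
  ring

lemma dist_fold_le {N : ℕ} {ν : Euc N} (hν : ‖ν‖ = 1) (x y : Euc N) :
    dist (fold ν x) (fold ν y) ≤ dist x y := by
  rw [dist_eq_norm, dist_eq_norm]
  refine le_of_sq_le_sq ?_ (norm_nonneg _)
  set s : ℝ := inner ℝ x ν with hs
  set t : ℝ := inner ℝ y ν with ht
  have h : fold ν x - fold ν y = (x - y) + ((|s| - s) - (|t| - t)) • ν := by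
    rw [fold, fold, ← hs, ← ht, sub_smul (|s| - s)]
    abel
  rw [h, norm_add_sq_real, real_inner_smul_right, inner_sub_left, ← hs, ← ht, norm_smul, hν,
    mul_one, Real.norm_eq_abs, sq_abs]
  nlinarith [le_abs_self (s * t), abs_mul s t, sq_abs s, sq_abs t]

lemma volume_inner_eq_zero {N : ℕ} {ν : Euc N} (hν : ‖ν‖ = 1) :
    volume {x : Euc N | (inner ℝ x ν : ℝ) = 0} = 0 := by
  have h : {x : Euc N | (inner ℝ x ν : ℝ) = 0} = ((Submodule.span ℝ {ν})ᗮ : Submodule ℝ (Euc N)) := by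
    ext x
    simp [Submodule.mem_orthogonal_singleton_iff_inner_left]
  rw [h]
  refine Measure.addHaar_submodule _ _ fun htop => ?_
  have : ν ∈ (Submodule.span ℝ {ν})ᗮ := htop ▸ Submodule.mem_top
  rw [Submodule.mem_orthogonal_singleton_iff_inner_left, real_inner_self_eq_norm_sq, hν] at this
  norm_num at this

lemma restrict_halfSp_add {N : ℕ} {ν : Euc N} (hν : ‖ν‖ = 1) {μ : Measure (Euc N)}
    (hμ : μ ≪ volume) : μ.restrict (halfSp ν) + μ.restrict (halfSp (-ν)) = μ := by
  rw [← Measure.restrict_union _ (measurableSet_halfSp _)]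
  · refine Measure.restrict_eq_self_of_ae_mem ?_
    have : ∀ᵐ x ∂μ, (inner ℝ x ν : ℝ) ≠ 0 :=
      hμ.ae_le (measure_eq_zero_iff_ae_notMem.1 (volume_inner_eq_zero hν))
    filter_upwards [this] with x hx
    rw [mem_union, mem_halfSp, mem_halfSp_neg]
    exact (lt_or_gt_of_ne hx).symm
  · refine Set.disjoint_left.2 fun x hx hx' => ?_
    rw [mem_halfSp_neg] at hx'
    exact lt_asymm hx hx'

lemma map_fold_volume {N : ℕ} {ν : Euc N} (hν : ‖ν‖ = 1) :
    (volume : Measure (Euc N)).map (fold ν) = (2 : ℝ≥0∞) • volume.restrict (halfSp ν) := by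
  have hmp := (LinearIsometryEquiv.measurePreserving
    ((Submodule.span ℝ {ν})ᗮ.reflection : Euc N ≃ₗᵢ[ℝ] Euc N)).restrict_preimage
    (measurableSet_halfSp ν)
  have hpre : (Submodule.span ℝ {ν})ᗮ.reflection ⁻¹' (halfSp ν) = halfSp (-ν) := by
    ext x
    rw [mem_preimage, reflection_eq hν, mem_halfSp, mem_halfSp_neg, inner_sub_left,
      real_inner_smul_left, real_inner_self_eq_norm_sq, hν]
    constructor <;> intro h <;> linarith
  rw [hpre] at hmp
  conv_lhs => rw [← restrict_halfSp_add hν (Measure.AbsolutelyContinuous.refl volume)]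
  rw [Measure.map_add _ _ (continuous_fold ν).measurable, two_smul]
  congr 1
  · conv_rhs => rw [← Measure.map_id (μ := volume.restrict (halfSp ν))]
    refine Measure.map_congr ?_
    filter_upwards [ae_restrict_mem (measurableSet_halfSp ν)] with x hx using fold_of_mem hx
  · conv_rhs => rw [← hmp.map_eq]
    refine Measure.map_congr ?_
    filter_upwards [ae_restrict_mem (measurableSet_halfSp (-ν))] with x hx using fold_of_neg hν hx

lemma map_fold_densM {N : ℕ} {ν : Euc N} (hν : ‖ν‖ = 1) {g : Euc N → ℝ} (hg : Measurable g) :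
    (densM volume (g ∘ fold ν)).map (fold ν) =
      (2 : ℝ≥0∞) • (densM volume g).restrict (halfSp ν) := by
  have hf := (continuous_fold ν).measurable
  have h : (densM volume (g ∘ fold ν)).map (fold ν) =
      ((volume : Measure (Euc N)).map (fold ν)).withDensity fun x => ENNReal.ofReal (g x) := by
    ext s hs
    rw [Measure.map_apply hf hs, densM, withDensity_apply _ (hf hs), withDensity_apply _ hs,
      Measure.restrict_map hf hs, lintegral_map (by fun_prop) hf]
    rfl
  rw [h, map_fold_volume hν, withDensity_smul_measure, densM,
    restrict_withDensity (measurableSet_halfSp ν)]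

lemma ae_comp_fold {N : ℕ} {ν : Euc N} (hν : ‖ν‖ = 1) {q : Euc N → Prop}
    (h : ∀ᵐ x ∂(volume : Measure (Euc N)), q x) :
    ∀ᵐ x ∂(volume : Measure (Euc N)), q (fold ν x) := by
  refine ae_of_ae_map (continuous_fold ν).measurable.aemeasurable ?_
  rw [map_fold_volume hν]
  exact Measure.ae_smul_measure (ae_restrict_of_ae h) _

lemma memA_comp_fold {N : ℕ} {ν : Euc N} (hν : ‖ν‖ = 1) {ρ : Euc N → ℝ} (hρ : memA volume 1 ρ)
    (hhalf : ∫ x in halfSp ν, ρ x = 1 / 2) : memA volume 1 (ρ ∘ fold ν) := by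
  have hf := (continuous_fold ν).measurable
  refine ⟨hρ.1.comp hf, ae_comp_fold hν hρ.2.1, ?_⟩
  have := integral_map (μ := (volume : Measure (Euc N))) hf.aemeasurable (f := ρ)
    hρ.1.aestronglyMeasurable
  simp only [Function.comp_apply]
  rw [← this, map_fold_volume hν, integral_smul_measure, hhalf]
  norm_num

lemma exists_half_plan {N : ℕ} {p : ℝ} (hp : 0 < p) {ν : Euc N} (hν : ‖ν‖ = 1) {ρ : Euc N → ℝ}
    (hρ : memA volume 1 ρ)
    (hmax : ∀ σ : Euc N → ℝ, memA volume 1 σ → WEnergyPow p volume σ ≤ WEnergyPow p volume ρ)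
    (hfin : WEnergyPow p volume ρ ≠ ∞)
    (hhalf : ∫ x in halfSp ν, ρ x = 1 / 2) {ε : ℝ≥0∞} (hε : ε ≠ 0) :
    ∃ π : Measure (Euc N × Euc N), π.map Prod.fst = (densM volume ρ).restrict (halfSp ν) ∧
      π.map Prod.snd ≤ (densM volume fun x => 1 - ρ x).restrict (halfSp ν) ∧
      π {z | z.2 ∈ halfSp (-ν)} = 0 ∧ tCost p π ≤ 2⁻¹ * (WEnergyPow p volume ρ + ε) := by
  have hf := (continuous_fold ν).measurable
  have hlt : WEnergyPow p volume (ρ ∘ fold ν) < WEnergyPow p volume ρ + ε :=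
    (hmax _ (memA_comp_fold hν hρ hhalf)).trans_lt (ENNReal.lt_add_right hfin hε)
  simp only [WEnergyPow, WpPow, iInf_lt_iff] at hlt
  obtain ⟨ρ', hadm, π₁, ⟨hfst, hsnd⟩, hcost⟩ := hlt
  have hF : Measurable (Prod.map (fold ν) (fold ν)) := hf.prodMap hf
  have hinv : ∀ μ : Measure (Euc N), (2⁻¹ : ℝ≥0∞) • (2 : ℝ≥0∞) • μ = μ := by
    intro μ
    rw [smul_smul, ENNReal.inv_mul_cancel (by simp) (by simp), one_smul]
  have hm1 : (π₁.map (Prod.map (fold ν) (fold ν))).map Prod.fst =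
      (densM volume (ρ ∘ fold ν)).map (fold ν) := by
    rw [← hfst, Measure.map_map measurable_fst hF, Measure.map_map hf measurable_fst]
    rfl
  have hm2 : (π₁.map (Prod.map (fold ν) (fold ν))).map Prod.snd =
      (densM volume ρ').map (fold ν) := by
    rw [← hsnd, Measure.map_map measurable_snd hF, Measure.map_map hf measurable_snd]
    rfl
  have hle : densM volume ρ' ≤ densM volume ((fun x => 1 - ρ x) ∘ fold ν) := by
    refine withDensity_mono ?_
    filter_upwards [hadm.2.2.1] with x hx
    refine ENNReal.ofReal_le_ofReal ?_
    simp only [Function.comp_apply] at hx ⊢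
    linarith
  refine ⟨(2⁻¹ : ℝ≥0∞) • π₁.map (Prod.map (fold ν) (fold ν)), ?_, ?_, ?_, ?_⟩
  · rw [Measure.map_smul, hm1, map_fold_densM hν hρ.1, hinv]
  · rw [Measure.map_smul, hm2, ← hinv (Measure.restrict _ _),
      ← map_fold_densM hν (g := fun x => 1 - ρ x) (measurable_const.sub hρ.1)]
    have := Measure.map_mono hle hf
    intro s
    simp only [Measure.smul_apply, smul_eq_mul]
    gcongr
  · have hms : MeasurableSet {z : Euc N × Euc N | z.2 ∈ halfSp (-ν)} :=
      measurable_snd (measurableSet_halfSp _)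
    rw [Measure.smul_apply, Measure.map_apply hF hms]
    have : Prod.map (fold ν) (fold ν) ⁻¹' {z : Euc N × Euc N | z.2 ∈ halfSp (-ν)} = ∅ := by
      refine eq_empty_of_forall_notMem fun z hz => ?_
      have hz' : fold ν z.2 ∈ halfSp (-ν) := hz
      rw [mem_halfSp_neg, inner_fold hν] at hz'
      exact absurd hz' (abs_nonneg _).not_gt
    simp [this]
  · have : tCost p (π₁.map (Prod.map (fold ν) (fold ν))) ≤ tCost p π₁ := by
      rw [tCost_map _ hF]
      refine lintegral_mono fun z => ENNReal.ofReal_le_ofReal ?_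
      exact Real.rpow_le_rpow dist_nonneg (dist_fold_le hν _ _) hp.le
    have h2 : tCost p ((2⁻¹ : ℝ≥0∞) • π₁.map (Prod.map (fold ν) (fold ν))) =
        2⁻¹ * tCost p (π₁.map (Prod.map (fold ν) (fold ν))) := by
      simp [tCost, lintegral_smul_measure]
    rw [h2]
    gcongr
    exact this.trans hcost.le

lemma exists_noncrossing_plan {N : ℕ} {p : ℝ} (hp : 0 < p) {ν : Euc N} (hν : ‖ν‖ = 1)
    {ρ : Euc N → ℝ} (hρ : memA volume 1 ρ)
    (hmax : ∀ σ : Euc N → ℝ, memA volume 1 σ → WEnergyPow p volume σ ≤ WEnergyPow p volume ρ)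
    (hfin : WEnergyPow p volume ρ ≠ ∞)
    (hhalf₁ : ∫ x in halfSp ν, ρ x = 1 / 2) (hhalf₂ : ∫ x in halfSp (-ν), ρ x = 1 / 2)
    {ε : ℝ≥0∞} (hε : ε ≠ 0) :
    ∃ π : Measure (Euc N × Euc N), AP volume ρ π ∧ tCost p π ≤ WEnergyPow p volume ρ + ε ∧
      π {z | z.1 ∈ halfSp ν ∧ z.2 ∈ halfSp (-ν)} = 0 := by
  obtain ⟨π₁, hf₁, hs₁, hn₁, hc₁⟩ := exists_half_plan hp hν hρ hmax hfin hhalf₁ hε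
  obtain ⟨π₂, hf₂, hs₂, -, hc₂⟩ :=
    exists_half_plan hp (ν := -ν) (by rwa [norm_neg]) hρ hmax hfin hhalf₂ hε
  have hac : ∀ g : Euc N → ℝ, densM volume g ≪ volume := fun g =>
    withDensity_absolutelyContinuous _ _
  refine ⟨π₁ + π₂, ⟨?_, ?_⟩, ?_, ?_⟩
  · rw [Measure.map_add _ _ measurable_fst, hf₁, hf₂, restrict_halfSp_add hν (hac _)]
  · rw [Measure.map_add _ _ measurable_snd, ← restrict_halfSp_add hν (hac fun x => 1 - ρ x)]
    exact add_le_add hs₁ hs₂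
  · calc tCost p (π₁ + π₂) = tCost p π₁ + tCost p π₂ := by simp [tCost, lintegral_add_measure]
      _ ≤ 2⁻¹ * (WEnergyPow p volume ρ + ε) + 2⁻¹ * (WEnergyPow p volume ρ + ε) := by gcongr
      _ = WEnergyPow p volume ρ + ε := by
        rw [← add_mul, ENNReal.inv_two_add_inv_two, one_mul]
  · rw [Measure.add_apply, add_eq_zero]
    refine ⟨measure_mono_null (fun z hz => hz.2) hn₁, ?_⟩
    refine measure_mono_null (t := Prod.fst ⁻¹' halfSp ν) (fun z hz => hz.1) ?_
    rw [← Measure.map_apply measurable_fst (measurableSet_halfSp ν), hf₂,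
      Measure.restrict_apply (measurableSet_halfSp ν)]
    convert measure_empty (μ := densM volume ρ)
    refine eq_empty_of_forall_notMem fun x hx => ?_
    exact lt_asymm (mem_halfSp.1 hx.1) (mem_halfSp_neg.1 hx.2)

open scoped Pointwise in
lemma ae_eventually_measure_prod_pos {N : ℕ} (π : Measure (Euc N × Euc N)) [IsFiniteMeasure π]
    (hac : π.map Prod.fst ≪ volume) :
    ∀ᵐ z ∂π, ∀ U ∈ nhds z.2, ∀ t : Set (Euc N), MeasurableSet t → volume t ≠ 0 → volume t ≠ ∞ →
      ∀ᶠ h : ℝ in nhdsWithin 0 (Ioi 0), π (({z.1} + h • t) ×ˢ U) ≠ 0 := by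
  let μ : Set (Euc N) → Measure (Euc N) := fun V => (π.restrict (Prod.snd ⁻¹' V)).map Prod.fst
  have hμac : ∀ V, μ V ≪ volume := fun V =>
    (Measure.absolutelyContinuous_of_le (Measure.map_mono Measure.restrict_le_self
      measurable_fst)).trans hac
  let S : Set (Euc N) → Set (Euc N) := fun V => {x | (μ V).rnDeriv volume x ≠ 0}
  have hzero : ∀ V T, μ V T = 0 ↔ volume (S V ∩ T) = 0 := by
    intro V T
    conv_lhs => rw [← Measure.withDensity_rnDeriv_eq (μ V) volume (hμac V)]
    exact withDensity_apply_eq_zero (Measure.measurable_rnDeriv _ _)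
  let D : Set (Euc N) → Euc N → Prop := fun V x =>
    Tendsto (fun r => volume (S V ∩ closedBall x r) / volume (closedBall x r))
      (nhdsWithin 0 (Ioi 0)) (nhds 1)
  have hSm : ∀ V, MeasurableSet (S V) := fun V =>
    (Measure.measurable_rnDeriv _ _) (measurableSet_singleton 0).compl
  have hD : ∀ V ∈ TopologicalSpace.countableBasis (Euc N), ∀ᵐ z ∂π, z.2 ∈ V → D V z.1 := by
    intro V hV
    have hVm : MeasurableSet (Prod.snd ⁻¹' V : Set (Euc N × Euc N)) :=
      measurable_snd (TopologicalSpace.isOpen_of_mem_countableBasis hV).measurableSet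
    have h1 : ∀ᵐ x ∂(volume : Measure (Euc N)), x ∈ S V → D V x :=
      (ae_restrict_iff' (hSm V)).1 (Besicovitch.ae_tendsto_measure_inter_div volume (S V))
    have h2 : ∀ᵐ x ∂(μ V), x ∈ S V := by
      rw [ae_iff]
      change μ V (S V)ᶜ = 0
      rw [hzero, inter_compl_self, measure_empty]
    have h3 : ∀ᵐ x ∂(μ V), D V x := by
      filter_upwards [(hμac V).ae_le h1, h2] with x hx1 hx2 using hx1 hx2
    exact (ae_restrict_iff' hVm).1 (ae_of_ae_map measurable_fst.aemeasurable h3)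
  filter_upwards [(ae_ball_iff (TopologicalSpace.countable_countableBasis (Euc N))).2 hD]
    with z hz U hU t ht ht0 httop
  obtain ⟨V, hV, hzV, hVU⟩ :=
    (TopologicalSpace.isBasis_countableBasis (Euc N)).mem_nhds_iff.1 hU
  have hlim := Measure.tendsto_addHaar_inter_smul_one_of_density_one volume (S V) z.1
    (hz V hV hzV) t ht ht0 httop
  filter_upwards [hlim.eventually (lt_mem_nhds (zero_lt_one' ℝ≥0∞)), self_mem_nhdsWithin]
    with h hh hpos
  have hpos : 0 < h := hpos
  intro hπ0
  have hTm : MeasurableSet ({z.1} + h • t) := by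
    rw [singleton_add, image_add_left]
    exact (measurable_const_add _) (ht.const_smul_of_ne_zero hpos.ne')
  have hVm : MeasurableSet V := (TopologicalSpace.isOpen_of_mem_countableBasis hV).measurableSet
  have : μ V ({z.1} + h • t) = 0 := by
    rw [Measure.map_apply measurable_fst hTm, Measure.restrict_apply (measurable_fst hTm)]
    exact measure_mono_null (Set.prod_mono_right hVU) hπ0
  rw [(hzero _ _).1 this, ENNReal.zero_div] at hh
  exact lt_irrefl _ hh

lemma fderiv_norm_rpow_injective {N : ℕ} {p : ℝ} (hp : 1 < p) :
    Function.Injective (fderiv ℝ fun z : Euc N => ‖z‖ ^ p) := by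
  intro z w h
  rw [(hasFDerivAt_norm_rpow z hp).fderiv, (hasFDerivAt_norm_rpow w hp).fderiv] at h
  have hzw : (‖z‖ ^ (p - 2)) • z = (‖w‖ ^ (p - 2)) • w := by
    refine ext_inner_right ℝ fun v => ?_
    have := congrArg (fun f => f v) h
    simp only [smul_apply, innerSL_apply_apply, smul_eq_mul, mul_assoc] at this
    rw [real_inner_smul_left, real_inner_smul_left]
    exact mul_left_cancel₀ (by linarith : p ≠ 0) this
  have hn : ∀ u : Euc N, ‖(‖u‖ ^ (p - 2)) • u‖ = ‖u‖ ^ (p - 1) := by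
    intro u
    rw [norm_smul, Real.norm_of_nonneg (Real.rpow_nonneg (norm_nonneg _) _)]
    rcases (norm_nonneg u).eq_or_lt with h0 | h0
    · rw [← h0, mul_zero, Real.zero_rpow (by linarith)]
    · rw [← Real.rpow_add_one h0.ne']
      congr 1
      ring
  have hnorm : ‖z‖ = ‖w‖ := by
    have := congrArg norm hzw
    rw [hn, hn] at this
    exact (Real.rpow_left_inj (norm_nonneg _) (norm_nonneg _) (by linarith)).1 this
  rw [hnorm] at hzw
  rcases (norm_nonneg w).eq_or_lt with h0 | h0
  · rw [norm_eq_zero.1 h0.symm, norm_eq_zero.1 (hnorm.trans h0.symm)]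
  · exact smul_right_injective _ (Real.rpow_pos_of_pos h0 _).ne' hzw

lemma exists_cone_swapGain_pos {N : ℕ} {p : ℝ} (hp : 1 < p) {x₀ y₀ y' : Euc N} (hy : y' ≠ y₀) :
    ∃ t : Set (Euc N), IsOpen t ∧ t.Nonempty ∧ Bornology.IsBounded t ∧
      ∀ᶠ z in nhds (x₀, y₀), ∀ v ∈ t, ∀ h : ℝ, 0 < h → z.1 = x₀ + h • v →
        0 < swapGain p z (x₀, y') := by
  set c : Euc N → ℝ := fun z => ‖z‖ ^ p with hc
  set L := fderiv ℝ c (x₀ - y₀) - fderiv ℝ c (x₀ - y') with hL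
  have hL0 : L ≠ 0 := by
    rw [hL, sub_ne_zero]
    refine fun h => hy ?_
    exact (sub_right_injective (fderiv_norm_rpow_injective hp h)).symm
  obtain ⟨e, he⟩ : ∃ e, 0 < L e := by
    obtain ⟨v, hv⟩ := ContinuousLinearMap.exists_ne_zero hL0
    rcases lt_or_gt_of_ne hv with h | h
    · exact ⟨-v, by rw [map_neg]; linarith⟩
    · exact ⟨v, h⟩
  set ε : ℝ := L e / (8 * (‖e‖ + 1)) with hε
  have hepos : 0 < ‖e‖ + 1 := by positivity
  have hεpos : 0 < ε := by positivity
  have hstrict : ∀ z : Euc N, HasStrictFDerivAt c (fderiv ℝ c z) z := fun z =>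
    (contDiff_norm_rpow hp).contDiffAt.hasStrictFDerivAt one_ne_zero
  have key : ∀ b : Euc N, ∀ᶠ z in nhds (x₀, b),
      ‖c (z.1 - z.2) - c (x₀ - z.2) - fderiv ℝ c (x₀ - b) (z.1 - x₀)‖ ≤ ε * ‖z.1 - x₀‖ := by
    intro b
    have h1 := (hstrict (x₀ - b)).isLittleO.def hεpos
    have h2 : Tendsto (fun z : Euc N × Euc N => (z.1 - z.2, x₀ - z.2)) (nhds (x₀, b))
        (nhds (x₀ - b, x₀ - b)) := by
      have : Continuous fun z : Euc N × Euc N => (z.1 - z.2, x₀ - z.2) := by fun_prop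
      exact this.tendsto (x₀, b)
    filter_upwards [h2.eventually h1] with z hz
    simpa using hz
  have key' : ∀ᶠ z in nhds (x₀, y₀),
      ‖c (z.1 - y') - c (x₀ - y') - fderiv ℝ c (x₀ - y') (z.1 - x₀)‖ ≤ ε * ‖z.1 - x₀‖ := by
    have h2 : Tendsto (fun z : Euc N × Euc N => (z.1, y')) (nhds (x₀, y₀)) (nhds (x₀, y')) := by
      have : Continuous fun z : Euc N × Euc N => (z.1, y') := by fun_prop
      exact this.tendsto (x₀, y₀)
    exact h2.eventually (key y')
  refine ⟨ball e 1 ∩ {v | L e / 2 < L v}, isOpen_ball.inter (isOpen_lt continuous_const L.continuous),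
    ⟨e, mem_ball_self one_pos, half_lt_self he⟩, isBounded_ball.subset inter_subset_left, ?_⟩
  filter_upwards [key y₀, key'] with z h1 h2 v hv h hh hz
  have hzx : z.1 - x₀ = h • v := by rw [hz]; abel
  have hvn : ‖v‖ ≤ ‖e‖ + 1 := by
    have : ‖v - e‖ < 1 := by simpa [dist_eq_norm] using hv.1
    linarith [norm_le_norm_add_norm_sub' v e]
  have hLv : L e / 2 < L v := hv.2
  rw [hzx, norm_smul, Real.norm_of_nonneg hh.le, map_smul, smul_eq_mul, Real.norm_eq_abs,
    abs_le] at h1 h2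
  have hεe : ε * ‖v‖ ≤ L e / 8 := by
    calc ε * ‖v‖ ≤ ε * (‖e‖ + 1) := by gcongr
      _ = L e / 8 := by rw [hε]; field_simp
  have hLv' : L v = fderiv ℝ c (x₀ - y₀) v - fderiv ℝ c (x₀ - y') v := rfl
  have hg : swapGain p z (x₀, y') = c (z.1 - z.2) + c (x₀ - y') - (c (z.1 - y') + c (x₀ - z.2)) := by
    simp only [swapGain, hc, dist_eq_norm]
  rw [hg]
  have e1 : h * (L e / 2) < h * L v := by gcongr
  have e2 : h * (ε * ‖v‖) ≤ h * (L e / 8) := by gcongr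
  have e3 : 0 < h * L e := mul_pos hh he
  rw [hLv', mul_sub] at e1
  nlinarith [h1.1, h2.2]

open scoped Pointwise in
lemma ae_measure_swapGain_pos {N : ℕ} {p : ℝ} (hp : 1 < p) (π : Measure (Euc N × Euc N))
    [IsFiniteMeasure π] (hac : π.map Prod.fst ≪ volume) :
    ∀ᵐ z ∂π, ∀ y', y' ≠ z.2 → π {q | 0 < swapGain p q (z.1, y')} ≠ 0 := by
  filter_upwards [ae_eventually_measure_prod_pos π hac] with z hz y' hy'
  obtain ⟨t, hto, htne, htb, ht⟩ := exists_cone_swapGain_pos hp (x₀ := z.1) hy'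
  rw [nhds_prod_eq] at ht
  obtain ⟨O, hO, U, hU, hOU⟩ := Filter.mem_prod_iff.1 ht
  have hev := hz U hU t hto.measurableSet (hto.measure_pos volume htne).ne' htb.measure_lt_top.ne
  have hsub : ∀ᶠ h : ℝ in nhdsWithin 0 (Ioi 0), {z.1} + h • t ⊆ O :=
    nhdsWithin_le_nhds (eventually_singleton_add_smul_subset htb hO)
  obtain ⟨h, h1, h2, h3⟩ := (hev.and (hsub.and self_mem_nhdsWithin)).exists
  refine fun h0 => h1 (measure_mono_null ?_ h0)
  rintro ⟨x, y⟩ ⟨hx, hyU⟩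
  have hxO := h2 hx
  rw [singleton_add] at hx
  obtain ⟨_, ⟨v, hv, rfl⟩, hxv⟩ := hx
  exact hOU (mk_mem_prod hxO hyU) v hv h h3 hxv.symm

lemma measure_dist_ge_le {N : ℕ} {p r : ℝ} (hp : 0 < p) (hr : 0 < r)
    (π : Measure (Euc N × Euc N)) :
    π {z | r ≤ dist z.1 z.2} ≤ tCost p π / ENNReal.ofReal (r ^ p) := by
  have hrp : 0 < r ^ p := Real.rpow_pos_of_pos hr p
  refine le_trans (measure_mono fun z hz => ?_)
    (meas_ge_le_lintegral_div (measurable_dist_rpow p).aemeasurable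
      (ENNReal.ofReal_pos.2 hrp).ne' ENNReal.ofReal_ne_top)
  exact ENNReal.ofReal_le_ofReal (Real.rpow_le_rpow hr.le hz hp.le)

lemma exists_measure_dist_ge_le {p : ℝ} (hp : 0 < p) (N : ℕ) {C m : ℝ≥0∞} (hC : C ≠ ∞)
    (hm : m ≠ 0) :
    ∃ r : ℝ, ∀ π : Measure (Euc N × Euc N), tCost p π ≤ C → π {z | r ≤ dist z.1 z.2} ≤ m := by
  have h1 : Tendsto (fun r : ℝ => C / ENNReal.ofReal (r ^ p)) atTop (nhds 0) := by
    have h2 : Tendsto (fun r : ℝ => ENNReal.ofReal (r ^ p)) atTop (nhds ∞) :=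
      ENNReal.tendsto_ofReal_atTop.comp (tendsto_rpow_atTop hp)
    simpa using ENNReal.Tendsto.const_div h2 (Or.inr hC)
  obtain ⟨r, hr, hr0⟩ :=
    ((h1.eventually (gt_mem_nhds (pos_iff_ne_zero.2 hm))).and (eventually_gt_atTop 0)).exists
  refine ⟨r, fun π hπ => (measure_dist_ge_le hp hr0 π).trans (le_trans ?_ hr.le)⟩
  gcongr

lemma continuous_lintegral_min_swapGain {N : ℕ} {p : ℝ} (hp : 0 ≤ p)
    (π : Measure (Euc N × Euc N)) [IsFiniteMeasure π] :
    Continuous fun w => ∫⁻ z, min 1 (ENNReal.ofReal (swapGain p z w)) ∂π := by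
  have hc : Continuous fun q : (Euc N × Euc N) × (Euc N × Euc N) =>
      min 1 (ENNReal.ofReal (swapGain p q.1 q.2)) :=
    continuous_const.min (ENNReal.continuous_ofReal.comp (continuous_swapGain hp))
  refine continuous_iff_continuousAt.2 fun w => ?_
  refine tendsto_lintegral_filter_of_dominated_convergence (fun _ => 1) ?_ ?_ (by simp) ?_
  · exact Eventually.of_forall fun w' =>
      (hc.comp (continuous_id.prodMk continuous_const)).measurable
  · exact Eventually.of_forall fun w' => Eventually.of_forall fun z => min_le_left _ _
  · exact Eventually.of_forall fun z =>
      (hc.comp (continuous_const.prodMk continuous_id)).tendsto w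

lemma lintegral_min_swapGain_ne_zero {N : ℕ} {p : ℝ} (hp : 0 ≤ p) {π : Measure (Euc N × Euc N)}
    {w : Euc N × Euc N} (h : π {q | 0 < swapGain p q w} ≠ 0) :
    ∫⁻ z, min 1 (ENNReal.ofReal (swapGain p z w)) ∂π ≠ 0 := by
  have hm : Measurable fun z => min 1 (ENNReal.ofReal (swapGain p z w)) :=
    (continuous_const.min (ENNReal.continuous_ofReal.comp ((continuous_swapGain hp).comp
      (continuous_id.prodMk continuous_const)))).measurable
  rw [Ne, lintegral_eq_zero_iff hm]
  refine fun h0 => h ?_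
  refine measure_mono_null (fun q hq => ?_) (ae_iff.1 h0)
  have hq' : 0 < swapGain p q w := hq
  simpa using hq'

lemma measure_crossing_eq_zero {N : ℕ} {p : ℝ} (hp : 1 < p) {ρ : Euc N → ℝ}
    (hρ : memA volume 1 ρ) {ν : Euc N} {π : Measure (Euc N × Euc N)} (hπ : AP volume ρ π)
    (hopt : tCost p π = WEnergyPow p volume ρ) (hfin : WEnergyPow p volume ρ ≠ ∞)
    (happrox : ∀ ε : ℝ≥0∞, ε ≠ 0 → ∃ π' : Measure (Euc N × Euc N), AP volume ρ π' ∧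
      tCost p π' ≤ WEnergyPow p volume ρ + ε ∧ π' {z | z.1 ∈ halfSp ν ∧ z.2 ∈ halfSp (-ν)} = 0) :
    π {z | z.1 ∈ halfSp ν ∧ z.2 ∈ halfSp (-ν)} = 0 := by
  have hp0 : 0 < p := by linarith
  have hprob : ∀ π' : Measure (Euc N × Euc N), AP volume ρ π' → IsProbabilityMeasure π' :=
    fun π' h => ⟨(measure_univ_of_map_fst h.1).trans (densM_univ_s11 hρ)⟩
  have := hprob π hπ
  by_contra hne
  set Cr : Set (Euc N × Euc N) := {z | z.1 ∈ halfSp ν ∧ z.2 ∈ halfSp (-ν)} with hCr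
  have hCrm : MeasurableSet Cr := (measurable_fst (measurableSet_halfSp ν)).inter
    (measurable_snd (measurableSet_halfSp (-ν)))
  have hac : π.map Prod.fst ≪ volume := by
    rw [hπ.1]; exact withDensity_absolutelyContinuous _ _
  set f : Euc N × Euc N → ℝ≥0∞ := fun w => ∫⁻ z, min 1 (ENNReal.ofReal (swapGain p z w)) ∂π
    with hf
  have hfc : Continuous f := continuous_lintegral_min_swapGain hp0.le π
  obtain ⟨Z, hZsub, hZm, hZ0⟩ := exists_measurable_superset_of_null
    (ae_iff.1 (ae_measure_swapGain_pos hp π hac))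
  have hpos : 0 < π (Cr \ Z) := by
    rw [measure_sdiff_null hZ0]; exact pos_iff_ne_zero.2 hne
  obtain ⟨𝒦, h𝒦sub, h𝒦c, h𝒦pos⟩ :=
    (hCrm.diff hZm).exists_lt_isCompact_of_ne_top (measure_ne_top π _) hpos
  set B : Set (Euc N) := Prod.fst '' 𝒦 with hB
  have hBc : IsCompact B := h𝒦c.image continuous_fst
  have hBm : MeasurableSet B := hBc.isClosed.measurableSet
  have hBhalf : B ⊆ halfSp ν := by
    rintro _ ⟨z, hz, rfl⟩
    exact (h𝒦sub hz).1.1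
  have hfpos : ∀ x ∈ B, ∀ y, y ∉ halfSp (-ν) → f (x, y) ≠ 0 := by
    rintro _ ⟨z, hz, rfl⟩ y hy
    refine lintegral_min_swapGain_ne_zero hp0.le ?_
    have hzZ : z ∉ Z := (h𝒦sub hz).2
    have hzs := not_not.1 fun h => hzZ (hZsub h)
    exact hzs y fun h => hy (h ▸ (h𝒦sub hz).1.2)
  set m : ℝ≥0∞ := π 𝒦 with hm
  have hmtop : m ≠ ∞ := measure_ne_top _ _
  have hmpos : m ≠ 0 := h𝒦pos.ne'
  have hBmass : ∀ π' : Measure (Euc N × Euc N), AP volume ρ π' → m ≤ π' (Prod.fst ⁻¹' B) := by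
    intro π' hπ'
    rw [← Measure.map_apply measurable_fst hBm, hπ'.1, ← hπ.1,
      Measure.map_apply measurable_fst hBm]
    exact measure_mono fun z hz => mem_image_of_mem _ hz
  obtain ⟨r, hr⟩ := exists_measure_dist_ge_le hp0 N (C := WEnergyPow p volume ρ + 1) (m := m / 2)
    (ENNReal.add_ne_top.2 ⟨hfin, ENNReal.one_ne_top⟩) (by simpa using hmpos)
  obtain ⟨R₀, hR₀⟩ := hBc.isBounded.subset_closedBall (0 : Euc N)
  set K : Set (Euc N) := closedBall 0 (R₀ + r) ∩ (halfSp (-ν))ᶜ with hK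
  have hHo : IsOpen (halfSp (-ν)) := isOpen_lt continuous_const (by fun_prop)
  have hKc : IsCompact K := (isCompact_closedBall _ _).inter_right hHo.isClosed_compl
  obtain ⟨t, ht0, ht⟩ : ∃ t : ℝ≥0∞, t ≠ 0 ∧ ∀ w ∈ B ×ˢ K, t ≤ f w := by
    rcases (B ×ˢ K).eq_empty_or_nonempty with h | h
    · exact ⟨1, one_ne_zero, fun w hw => by simp [h] at hw⟩
    · obtain ⟨w, hw, hmin⟩ := (hBc.prod hKc).exists_isMinOn h hfc.continuousOn
      exact ⟨f w, hfpos _ hw.1 _ hw.2.2, fun w' hw' => hmin hw'⟩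
  have hlow : ∀ ε : ℝ≥0∞, ε ≠ 0 → ε ≤ 1 → t * (m / 2) ≤ ε := by
    intro ε hε hε1
    obtain ⟨π', hπ', hcost, hcr⟩ := happrox ε hε
    have := hprob π' hπ'
    have hgain := lintegral_swapGain_le hp0.le hρ hπ hπ' hopt (hopt ▸ hfin)
      (ne_top_of_le_ne_top ENNReal.one_ne_top hε1) (hopt.symm ▸ hcost)
    have hcm : Measurable fun q : (Euc N × Euc N) × (Euc N × Euc N) =>
        ENNReal.ofReal (swapGain p q.1 q.2) :=
      (continuous_swapGain hp0.le).measurable.ennreal_ofReal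
    rw [lintegral_prod_symm _ hcm.aemeasurable] at hgain
    have hmass : m / 2 ≤ π' (B ×ˢ K) := by
      have hsub : Prod.fst ⁻¹' B ⊆ B ×ˢ K ∪ ({z | r ≤ dist z.1 z.2} ∪ Cr) := by
        intro z hz
        by_cases h1 : z.2 ∈ halfSp (-ν)
        · exact Or.inr (Or.inr ⟨hBhalf hz, h1⟩)
        by_cases h2 : r ≤ dist z.1 z.2
        · exact Or.inr (Or.inl h2)
        refine Or.inl ⟨hz, ?_, h1⟩
        have h3 : dist z.1 0 ≤ R₀ := hR₀ hz
        rw [mem_closedBall]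
        have := dist_triangle_left z.2 0 z.1
        linarith [not_le.1 h2]
      have h1 : m / 2 + m / 2 ≤ π' (B ×ˢ K) + m / 2 := by
        calc m / 2 + m / 2 = m := ENNReal.add_halves m
          _ ≤ π' (Prod.fst ⁻¹' B) := hBmass π' hπ'
          _ ≤ π' (B ×ˢ K) + (π' {z | r ≤ dist z.1 z.2} + π' Cr) :=
            (measure_mono hsub).trans ((measure_union_le _ _).trans
              (by gcongr; exact measure_union_le _ _))
          _ ≤ π' (B ×ˢ K) + m / 2 := by
            rw [hcr, add_zero]
            gcongr
            exact hr π' (hcost.trans (by gcongr))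
      exact (ENNReal.add_le_add_iff_right (ENNReal.div_ne_top hmtop (by simp))).1 h1
    calc t * (m / 2) ≤ t * π' (B ×ˢ K) := by gcongr
      _ = ∫⁻ _ in B ×ˢ K, t ∂π' := by rw [setLIntegral_const]
      _ ≤ ∫⁻ w in B ×ˢ K, f w ∂π' :=
        setLIntegral_mono' (hBm.prod hKc.isClosed.measurableSet) ht
      _ ≤ ∫⁻ w, f w ∂π' := setLIntegral_le_lintegral _ _
      _ ≤ ∫⁻ w, ∫⁻ z, ENNReal.ofReal (swapGain p z w) ∂π ∂π' :=
        lintegral_mono fun w => lintegral_mono fun z => min_le_right _ _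
      _ ≤ ε := hgain
  have hprod : t * (m / 2) ≠ 0 := mul_ne_zero ht0 (by simpa using hmpos)
  set s := t * (m / 2) with hs
  have hs1 : s ≤ 1 := hlow 1 one_ne_zero le_rfl
  have hs_ne_top : s ≠ ∞ := ne_top_of_le_ne_top ENNReal.one_ne_top hs1
  exact absurd (hlow (s / 2) (by simpa using hprod) (ENNReal.half_le_self.trans hs1))
    (ENNReal.half_lt_self hprod hs_ne_top).not_ge

/-- If `ρ` is a maximizer of `𝒲_p` over `A` and the hyperplane orthogonal to `ν`
splits the mass of `ρ` in half, then the optimal plan `π_ρ` transports no mass across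
that hyperplane. -/
theorem maximizer_no_crossing {N : ℕ} (p : ℝ) (hp : 1 < p)
    (ρ : Euc N → ℝ) (hρ : memA volume 1 ρ)
    (hmax : ∀ σ : Euc N → ℝ, memA volume 1 σ → WEnergy p volume σ ≤ WEnergy p volume ρ)
    (ν : Euc N) (hν : ‖ν‖ = 1)
    (hhalf₁ : ∫ x in {x : Euc N | 0 < (inner ℝ x ν : ℝ)}, ρ x = 1/2)
    (hhalf₂ : ∫ x in {x : Euc N | (inner ℝ x ν : ℝ) < 0}, ρ x = 1/2)
    (η : Euc N → ℝ) (hη : Adm volume ρ η)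
    (hη_opt : WpPow p (densM volume ρ) (densM volume η) = WEnergyPow p volume ρ)
    (π : Measure (Euc N × Euc N)) (hπ : IsCoupling π (densM volume ρ) (densM volume η))
    (hπ_opt : tCost p π = WpPow p (densM volume ρ) (densM volume η)) :
    π {z : Euc N × Euc N | (inner ℝ z.1 ν : ℝ) * (inner ℝ z.2 ν : ℝ) < 0} = 0 := by
  have hp0 : 0 < p := by linarith
  have : Nontrivial (Euc N) := ⟨ν, 0, fun h => by simp [h] at hν⟩
  have hmax' : ∀ σ : Euc N → ℝ, memA volume 1 σ → WEnergyPow p volume σ ≤ WEnergyPow p volume ρ :=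
    fun σ hσ => (ENNReal.rpow_le_rpow_iff (one_div_pos.2 hp0)).1 (hmax σ hσ)
  have hfin : WEnergyPow p volume ρ ≠ ∞ := by
    obtain ⟨π₀, hπ₀, hlt⟩ := exists_AP_tCost_lt_top_s11 hp0.le hρ
    exact ((wEnergyPow_le_tCost hρ hπ₀).trans_lt hlt).ne
  have hAP : AP volume ρ π := by
    refine ⟨hπ.1, hπ.2.le.trans (withDensity_mono ?_)⟩
    filter_upwards [hη.2.2.1] with x hx
    exact ENNReal.ofReal_le_ofReal (by linarith)
  have hopt := hπ_opt.trans hη_opt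
  have hneg : {x : Euc N | (inner ℝ x ν : ℝ) < 0} = halfSp (-ν) :=
    Set.ext fun x => mem_halfSp_neg.symm
  rw [hneg] at hhalf₂
  have h1 := measure_crossing_eq_zero (ν := ν) hp hρ hAP hopt hfin fun ε hε =>
    exists_noncrossing_plan hp0 hν hρ hmax' hfin hhalf₁ hhalf₂ hε
  have h2 := measure_crossing_eq_zero (ν := -ν) hp hρ hAP hopt hfin fun ε hε =>
    exists_noncrossing_plan hp0 (by rwa [norm_neg]) hρ hmax' hfin hhalf₂
      (by rw [neg_neg]; exact hhalf₁) hε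
  refine measure_mono_null (fun z hz => ?_) (measure_union_null h1 h2)
  rcases mul_neg_iff.1 (show (inner ℝ z.1 ν : ℝ) * (inner ℝ z.2 ν : ℝ) < 0 from hz) with h | h
  · exact Or.inl ⟨h.1, mem_halfSp_neg.2 h.2⟩
  · exact Or.inr ⟨mem_halfSp_neg.2 h.1, by rw [neg_neg]; exact h.2⟩
end
end
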